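/- Let k be a field of characteristic zero and B a standard graded artinian k-algebra. Then the algebra B ⊗_k k[x₁,…,xₙ]/(x₁^{d₁},…,xₙ^{dₙ}) has the strong Lefschetz property for every n ≥ 1 and all integers d₁,…,dₙ ≥ 1, if and only if B is almost centered and has the strong Lefschetz property. -/

import Mathlib

open scoped BigOperators

/-- Multiplication by `a` is injective as a map on the subspace `V`. -/
def MulInjOn {k R : Type*} [Field k] [CommRing R] [Algebra k R]
    (V : Submodule k R) (a : R) : Prop :=
  ∀ v ∈ V, a * v = 0 → v = 0

/-- Multiplication by `a` maps the subspace `V` onto the subspace `W`. -/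
def MulSurjOnto {k R : Type*} [Field k] [CommRing R] [Algebra k R]
    (V W : Submodule k R) (a : R) : Prop :=
  ∀ w ∈ W, ∃ v ∈ V, a * v = w

/-- The multiplication map `·a : V → W` has full rank: it is injective or surjective. -/
def MulFullRank {k R : Type*} [Field k] [CommRing R] [Algebra k R]
    (V W : Submodule k R) (a : R) : Prop :=
  MulInjOn V a ∨ MulSurjOnto V W a

/-- `𝒜` is the grading of a standard graded artinian `k`-algebra structure on `R`:
the components form an internal direct sum, vanish in negative degrees, are
multiplicative, the degree-zero part is spanned by `1`, the algebra is generated in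
degree one, and `R` is a finite-dimensional `k`-vector space (equivalently, artinian). -/
structure IsStdGradedArtinian (k : Type*) [Field k] (R : Type*) [CommRing R] [Algebra k R]
    (𝒜 : ℤ → Submodule k R) : Prop where
  internal : DirectSum.IsInternal 𝒜
  one_mem : (1 : R) ∈ 𝒜 0
  mul_mem : ∀ {i j : ℤ} {a b : R}, a ∈ 𝒜 i → b ∈ 𝒜 j → a * b ∈ 𝒜 (i + j)
  neg_bot : ∀ i : ℤ, i < 0 → 𝒜 i = ⊥
  zero_spanOne : 𝒜 0 = Submodule.span k {(1 : R)}
  succ_eq : ∀ i : ℤ, 0 ≤ i → 𝒜 (i + 1) = 𝒜 1 * 𝒜 i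
  finiteDim : FiniteDimensional k R

/-- `A` (graded by `ℬ`) is the extension `B ⊗ₖ k[x]/(x^d)` of `B` (graded by `𝒜`):
`φ` is the canonical inclusion of `B`, `x` has degree one with `x^d = 0`, and each
graded component decomposes as `ℬ j = ⊕_{q=0}^{d-1} x^q · φ(𝒜 (j - q))`. -/
structure IsCIExtension {k B A : Type*} [Field k] [CommRing B] [Algebra k B]
    [CommRing A] [Algebra k A]
    (𝒜 : ℤ → Submodule k B) (ℬ : ℤ → Submodule k A)
    (φ : B →ₐ[k] A) (x : A) (d : ℕ) : Prop where
  map_mem : ∀ (j : ℤ) (b : B), b ∈ 𝒜 j → φ b ∈ ℬ j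
  x_mem : x ∈ ℬ 1
  x_pow : x ^ d = 0
  decomp_mem : ∀ (j : ℤ) (f : Fin d → B), (∀ q : Fin d, f q ∈ 𝒜 (j - ((q : ℕ) : ℤ))) →
    (∑ q : Fin d, x ^ (q : ℕ) * φ (f q)) ∈ ℬ j
  decomp_exists : ∀ (j : ℤ), ∀ c ∈ ℬ j, ∃ f : Fin d → B,
    (∀ q : Fin d, f q ∈ 𝒜 (j - ((q : ℕ) : ℤ))) ∧ c = ∑ q : Fin d, x ^ (q : ℕ) * φ (f q)
  decomp_unique : ∀ (j : ℤ) (f : Fin d → B), (∀ q : Fin d, f q ∈ 𝒜 (j - ((q : ℕ) : ℤ))) →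
    (∑ q : Fin d, x ^ (q : ℕ) * φ (f q)) = 0 → ∀ q : Fin d, f q = 0

/-- `A` (graded by `ℬ`) is the extension `B ⊗ₖ k[x₁,…,xₙ]/(x₁^{d₁},…,xₙ^{dₙ})` of `B`
(graded by `𝒜`). -/
structure IsMultiCIExtension {k B A : Type*} [Field k] [CommRing B] [Algebra k B]
    [CommRing A] [Algebra k A] {n : ℕ}
    (𝒜 : ℤ → Submodule k B) (ℬ : ℤ → Submodule k A)
    (φ : B →ₐ[k] A) (x : Fin n → A) (dv : Fin n → ℕ) : Prop where
  map_mem : ∀ (j : ℤ) (b : B), b ∈ 𝒜 j → φ b ∈ ℬ j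
  x_mem : ∀ m : Fin n, x m ∈ ℬ 1
  x_pow : ∀ m : Fin n, x m ^ dv m = 0
  decomp_mem : ∀ (j : ℤ) (f : ((m : Fin n) → Fin (dv m)) → B),
    (∀ e, f e ∈ 𝒜 (j - ∑ m : Fin n, ((e m : ℕ) : ℤ))) →
    (∑ e : (m : Fin n) → Fin (dv m), (∏ m : Fin n, x m ^ ((e m : ℕ))) * φ (f e)) ∈ ℬ j
  decomp_exists : ∀ (j : ℤ), ∀ c ∈ ℬ j, ∃ f : ((m : Fin n) → Fin (dv m)) → B,
    (∀ e, f e ∈ 𝒜 (j - ∑ m : Fin n, ((e m : ℕ) : ℤ))) ∧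
    c = ∑ e : (m : Fin n) → Fin (dv m), (∏ m : Fin n, x m ^ ((e m : ℕ))) * φ (f e)
  decomp_unique : ∀ (j : ℤ) (f : ((m : Fin n) → Fin (dv m)) → B),
    (∀ e, f e ∈ 𝒜 (j - ∑ m : Fin n, ((e m : ℕ) : ℤ))) →
    (∑ e : (m : Fin n) → Fin (dv m), (∏ m : Fin n, x m ^ ((e m : ℕ))) * φ (f e)) = 0 →
    ∀ e, f e = 0

/-- The weak Lefschetz property. -/
def HasWLP {k R : Type*} [Field k] [CommRing R] [Algebra k R]
    (𝒜 : ℤ → Submodule k R) : Prop :=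
  ∃ ℓ ∈ 𝒜 1, ∀ i : ℤ, 0 ≤ i → MulFullRank (𝒜 i) (𝒜 (i + 1)) ℓ

/-- The strong Lefschetz property. -/
def HasSLP {k R : Type*} [Field k] [CommRing R] [Algebra k R]
    (𝒜 : ℤ → Submodule k R) : Prop :=
  ∃ ℓ ∈ 𝒜 1, ∀ i : ℤ, 0 ≤ i → ∀ t : ℕ, 1 ≤ t → MulFullRank (𝒜 i) (𝒜 (i + t)) (ℓ ^ t)

/-- The Hilbert function of the graded algebra. -/
noncomputable def hilb {k R : Type*} [Field k] [CommRing R] [Algebra k R]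
    (𝒜 : ℤ → Submodule k R) (i : ℤ) : ℕ :=
  Module.finrank k (𝒜 i)

/-- The algebra is almost centered. -/
def AlmostCentered {k R : Type*} [Field k] [CommRing R] [Algebra k R]
    (𝒜 : ℤ → Submodule k R) : Prop :=
  ∀ i j : ℤ, i < j →
    (hilb 𝒜 i < hilb 𝒜 j → ∀ s : ℕ, hilb 𝒜 (i - s) ≤ hilb 𝒜 (j + s)) ∧
    (hilb 𝒜 j < hilb 𝒜 i → ∀ s : ℕ, hilb 𝒜 (j + s) ≤ hilb 𝒜 (i - s))

/-- `binomZ t j` is the binomial coefficient `t` choose `j` for an integer `j`,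
equal to `0` for `j < 0` or `j > t`. -/
def binomZ (t : ℕ) (j : ℤ) : ℤ := if 0 ≤ j then (t.choose j.toNat : ℤ) else 0

/-- The `(d-p) × (d-p)` integer matrix `C_{t,p,d}` whose `(r,c)` entry (with `1 ≤ r,c ≤ d-p`)
is `binom(t, d+1-r-c)`. -/
def Cmat (t p d : ℕ) : Matrix (Fin (d - p)) (Fin (d - p)) ℤ :=
  Matrix.of fun r c => binomZ t ((d : ℤ) - 1 - (r : ℕ) - (c : ℕ))

/-- The characteristic of `k` is zero, or a prime not dividing the integer `N`. -/
def CharCond (k : Type*) [Field k] (N : ℤ) : Prop :=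
  CharZero k ∨ ∃ p : ℕ, p.Prime ∧ CharP k p ∧ ¬ ((p : ℤ) ∣ N)

section MultiIndex

variable {k M ι : Type*} [Field k] [AddCommGroup M] [Module k M] [DecidableEq ι]

/-- Formal multiplication by the `m`-th variable on families of coefficients. -/
def shiftOp (k M : Type*) {ι : Type*} [Field k] [AddCommGroup M] [Module k M] [DecidableEq ι]
    (m : ι) : Module.End k ((ι → ℕ) → M) where
  toFun f e := if e m = 0 then 0 else f (e - Pi.single m 1)
  map_add' f g := by ext e; by_cases h : e m = 0 <;> simp [h]
  map_smul' c f := by ext e; by_cases h : e m = 0 <;> simp [h]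

/-- Formal differentiation with respect to the `m`-th variable on families of coefficients. -/
def diffOp (k M : Type*) {ι : Type*} [Field k] [AddCommGroup M] [Module k M] [DecidableEq ι]
    (m : ι) : Module.End k ((ι → ℕ) → M) where
  toFun f e := ((e m + 1 : ℕ) : k) • f (e + Pi.single m 1)
  map_add' f g := by ext e; simp
  map_smul' c f := by ext e; simp only [Pi.smul_apply, RingHom.id_apply]; rw [smul_comm]

/-- The operator `L + ∑ xₘ` on families of coefficients. -/
def extOp [Fintype ι] (L : Module.End k M) : Module.End k ((ι → ℕ) → M) :=
  L.compLeft (ι → ℕ) + ∑ m, shiftOp k M m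

lemma shiftOp_apply (m : ι) (f : (ι → ℕ) → M) (e : ι → ℕ) :
    shiftOp k M m f e = if e m = 0 then 0 else f (e - Pi.single m 1) := rfl

lemma diffOp_apply (m : ι) (f : (ι → ℕ) → M) (e : ι → ℕ) :
    diffOp k M m f e = ((e m + 1 : ℕ) : k) • f (e + Pi.single m 1) := rfl

lemma extOp_apply [Fintype ι] (L : Module.End k M) (f : (ι → ℕ) → M) (e : ι → ℕ) :
    extOp L f e = L (f e) + ∑ m, if e m = 0 then 0 else f (e - Pi.single m 1) := by
  simp [extOp, shiftOp_apply]

lemma diffOp_shiftOp_self (m : ι) (f : (ι → ℕ) → M) :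
    diffOp k M m (shiftOp k M m f) = shiftOp k M m (diffOp k M m f) + f := by
  ext e
  by_cases h : e m = 0
  · simp [diffOp_apply, shiftOp_apply, h]
  · have h1 : e - Pi.single m 1 + Pi.single m 1 = e := by
      ext j
      by_cases hj : j = m
      · subst hj; simp; omega
      · simp [hj]
    have h2 : e m - 1 + 1 = e m := by omega
    simp only [diffOp_apply, shiftOp_apply, h, Pi.add_apply, Pi.sub_apply, Pi.single_eq_same,
      h1, h2, if_false, add_tsub_cancel_right]
    rw [if_neg (by omega)]
    push_cast
    rw [add_smul, one_smul]

lemma diffOp_shiftOp_of_ne {m j : ι} (hmj : m ≠ j) (f : (ι → ℕ) → M) :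
    diffOp k M m (shiftOp k M j f) = shiftOp k M j (diffOp k M m f) := by
  ext e
  by_cases h : e j = 0
  · simp [diffOp_apply, shiftOp_apply, h, hmj.symm]
  · have h1 : e + Pi.single m 1 - Pi.single j 1 = e - Pi.single j 1 + Pi.single m 1 := by
      ext l
      by_cases hl : l = j
      · subst hl; simp [hmj.symm]
      · simp [hl]
    simp [diffOp_apply, shiftOp_apply, h, hmj.symm, hmj, h1]

lemma diffOp_extOp [Fintype ι] (L : Module.End k M) (m : ι) (f : (ι → ℕ) → M) :
    diffOp k M m (extOp L f) = extOp L (diffOp k M m f) + f := by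
  have hL : diffOp k M m (L.compLeft (ι → ℕ) f) = L.compLeft (ι → ℕ) (diffOp k M m f) := by
    ext e; simp [diffOp_apply]
  have hS : ∑ j, diffOp k M m (shiftOp k M j f) =
      ∑ j, shiftOp k M j (diffOp k M m f) + f := by
    rw [← Finset.add_sum_erase _ _ (Finset.mem_univ m), diffOp_shiftOp_self,
      ← Finset.add_sum_erase _ (fun j => shiftOp k M j (diffOp k M m f)) (Finset.mem_univ m),
      Finset.sum_congr rfl fun j hj => diffOp_shiftOp_of_ne (Finset.ne_of_mem_erase hj).symm f]
    abel
  simp only [extOp, LinearMap.add_apply, LinearMap.sum_apply, map_add, map_sum, hL, hS]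
  abel

lemma extOp_pow_succ_apply [Fintype ι] (L : Module.End k M) (t : ℕ) (f : (ι → ℕ) → M) :
    (extOp L ^ (t + 1)) f = extOp L ((extOp L ^ t) f) := by
  rw [pow_succ', Module.End.mul_apply]

lemma diffOp_extOp_pow_succ [Fintype ι] (L : Module.End k M) (m : ι) (t : ℕ)
    (f : (ι → ℕ) → M) :
    diffOp k M m ((extOp L ^ (t + 1)) f) =
      (extOp L ^ (t + 1)) (diffOp k M m f) + ((t + 1 : ℕ) : k) • (extOp L ^ t) f := by
  induction t with
  | zero => simp [diffOp_extOp]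
  | succ t ih =>
    rw [extOp_pow_succ_apply L (t + 1) f, diffOp_extOp, ih, map_add, map_smul,
      ← extOp_pow_succ_apply, ← extOp_pow_succ_apply, Nat.cast_succ (t + 1), add_smul, one_smul,
        add_assoc]

/-- The family `f` vanishes at all multi-indices bounded by `a`. -/
def VanishesUpTo (a : ι → ℕ) (f : (ι → ℕ) → M) : Prop :=
  ∀ e ≤ a, f e = 0

lemma VanishesUpTo.extOp_pow [Fintype ι] {a : ι → ℕ} {f : (ι → ℕ) → M} (hf : VanishesUpTo a f)
    (L : Module.End k M) (t : ℕ) : VanishesUpTo a ((extOp L ^ t) f) := by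
  induction t with
  | zero => simpa using hf
  | succ t ih =>
    intro e he
    rw [pow_succ', Module.End.mul_apply, extOp_apply, ih e he, map_zero, zero_add]
    refine Finset.sum_eq_zero fun m _ => ?_
    split_ifs
    · rfl
    · exact ih _ (tsub_le_self.trans he)

lemma VanishesUpTo.derivative {a : ι → ℕ} {m : ι} {f : (ι → ℕ) → M}
    (hf : VanishesUpTo (a + Pi.single m 1) f) : VanishesUpTo a (diffOp k M m f) := by
  intro e he
  rw [diffOp_apply, hf _ (by gcongr), smul_zero]

lemma extOp_pow_apply_zero [Fintype ι] (L : Module.End k M) (t : ℕ) (f : (ι → ℕ) → M) :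
    (extOp L ^ t) f 0 = (L ^ t) (f 0) := by
  induction t with
  | zero => simp
  | succ t ih =>
    rw [pow_succ', Module.End.mul_apply, extOp_apply, ih, pow_succ', Module.End.mul_apply]
    simp

/-- `L ^ t` is injective on the degree `i` piece whenever `2 i + t ≤ N`. -/
def InjBelow (L : Module.End k M) (ℳ : ℤ → Submodule k M) (N : ℤ) : Prop :=
  ∀ (i : ℤ) (t : ℕ), 2 * i + t ≤ N → ∀ v ∈ ℳ i, (L ^ t) v = 0 → v = 0

/-- Injectivity below the centre is inherited by the extension by truncated variables. -/
theorem InjBelow.vanishesUpTo [Fintype ι] [CharZero k] {L : Module.End k M} {ℳ : ℤ → Submodule k M}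
    {N : ℤ} (hL : InjBelow L ℳ N) (a : ι → ℕ) (i : ℤ) (t : ℕ) (f : (ι → ℕ) → M)
    (hN : 2 * i + t ≤ N + ∑ m, (a m : ℤ)) (hf : ∀ e ≤ a, f e ∈ ℳ (i - ∑ m, (e m : ℤ)))
    (hv : VanishesUpTo a ((extOp L ^ t) f)) : VanishesUpTo a f := by
  obtain ⟨S, hS⟩ : ∃ S, ∑ m, a m = S := ⟨_, rfl⟩
  induction S generalizing a i t f with
  | zero =>
    have ha : a = 0 := by
      ext m
      exact (Finset.sum_eq_zero_iff.1 hS) m (Finset.mem_univ m)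
    subst ha
    intro e he
    obtain rfl : e = 0 := le_antisymm he zero_le
    have h0 := hv 0 le_rfl
    rw [extOp_pow_apply_zero] at h0
    refine hL i t (by simpa using hN) _ (by simpa using hf 0 le_rfl) h0
  | succ S ih =>
    have hsplit : ∀ m, a m ≠ 0 → ∃ b : ι → ℕ, a = b + Pi.single m 1 := by
      intro m hm
      refine ⟨a - Pi.single m 1, ?_⟩
      ext j
      by_cases hj : j = m
      · subst hj; simp; omega
      · simp [hj]
    have hne : ∀ e ≤ a, e ≠ 0 → f e = 0 := by
      intro e he he0
      obtain ⟨m, hm⟩ := Function.ne_iff.1 he0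
      have hm' : e m ≠ 0 := hm
      have hma : a m ≠ 0 := ((Nat.pos_of_ne_zero hm').trans_le (he m)).ne'
      obtain ⟨b, rfl⟩ := hsplit m hma
      have hsum : ∑ j, (b j : ℤ) + 1 = ∑ j, ((b + Pi.single m 1 : ι → ℕ) j : ℤ) := by
        simp [Finset.sum_add_distrib, Pi.single_apply]
      have hD : VanishesUpTo b (diffOp k M m f) := by
        refine ih b (i - 1) (t + 1) _ ?_ ?_ ?_ ?_
        · push_cast; linarith
        · intro c hc
          rw [diffOp_apply]
          refine Submodule.smul_mem _ _ ?_
          have := hf (c + Pi.single m 1) (by gcongr)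
          convert this using 2
          simp [Finset.sum_add_distrib, Pi.single_apply]
          ring
        · have h1 := hv.derivative (k := k)
          have h2 := h1.extOp_pow L 1
          intro c hc
          have h3 := h2 c hc
          cases t with
          | zero =>
            simpa using h3
          | succ t =>
            rw [diffOp_extOp_pow_succ, pow_one, map_add, map_smul, ← extOp_pow_succ_apply,
              ← extOp_pow_succ_apply, Pi.add_apply, Pi.smul_apply,
              hv c (hc.trans le_self_add), smul_zero, add_zero] at h3
            exact h3
        · simp [Finset.sum_add_distrib, Pi.single_apply] at hS
          exact hS
      have he' : e - Pi.single m 1 + Pi.single m 1 = e := by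
        ext j
        by_cases hj : j = m
        · subst hj; simp; omega
        · simp [hj]
      have h4 := hD (e - Pi.single m 1) (by
        intro j
        have := he j
        simp only [Pi.add_apply, Pi.sub_apply] at this ⊢
        omega)
      rw [diffOp_apply, he', smul_eq_zero] at h4
      exact h4.resolve_left (Nat.cast_ne_zero.2 (Nat.succ_ne_zero _))
    cases t with
    | zero => simpa using hv
    | succ t =>
      obtain ⟨m, hm⟩ : ∃ m, a m ≠ 0 := by
        by_contra! h
        simp [h] at hS
      obtain ⟨b, rfl⟩ := hsplit m hm
      set g : (ι → ℕ) → M := Pi.single 0 (f 0) with hg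
      have hg0 : ∀ e, e ≠ 0 → g e = 0 := fun e he => by simp [hg, he]
      have hfg : VanishesUpTo (b + Pi.single m 1) (f - g) := by
        intro e he
        by_cases h : e = 0
        · subst h; simp [hg]
        · simp [hg0 e h, hne e he h]
      have hDg : diffOp k M m g = 0 := by
        ext e
        rw [diffOp_apply, hg0 _ (fun h => by simpa using congrFun h m), smul_zero]
        rfl
      have hvg : VanishesUpTo (b + Pi.single m 1) ((extOp L ^ (t + 1)) g) := by
        intro e he
        have := hfg.extOp_pow L (t + 1) e he
        rw [map_sub, Pi.sub_apply, hv e he, zero_sub, neg_eq_zero] at this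
        exact this
      have hvb : VanishesUpTo b ((extOp L ^ t) g) := by
        intro e he
        have := hvg.derivative (k := k) e he
        rw [diffOp_extOp_pow_succ, hDg, map_zero, zero_add, Pi.smul_apply, smul_eq_zero] at this
        exact this.resolve_left (Nat.cast_ne_zero.2 (Nat.succ_ne_zero _))
      have hb := ih b i t g ?_ ?_ hvb ?_
      · intro e he
        by_cases h : e = 0
        · subst h
          simpa [hg] using hb 0 zero_le
        · exact hne e he h
      · simp [Finset.sum_add_distrib, Pi.single_apply] at hN
        linarith
      · intro e he
        by_cases h : e = 0
        · subst h
          simpa [hg] using hf 0 zero_le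
        · rw [hg0 e h]; exact zero_mem _
      · simp [Finset.sum_add_distrib, Pi.single_apply] at hS
        exact hS

end MultiIndex
/-- Powers of `ℓ` act injectively below and surjectively above the centre `N`. -/
def CenteredAt {k R : Type*} [Field k] [CommRing R] [Algebra k R]
    (𝒜 : ℤ → Submodule k R) (ℓ : R) (N : ℤ) : Prop :=
  (∀ (i : ℤ) (t : ℕ), 2 * i + t ≤ N → MulInjOn (𝒜 i) (ℓ ^ t)) ∧
  (∀ (i : ℤ) (t : ℕ), N < 2 * i + t → MulSurjOnto (𝒜 i) (𝒜 (i + t)) (ℓ ^ t))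

section Extension

variable {k B A : Type*} [Field k] [CommRing B] [Algebra k B] [CommRing A] [Algebra k A]

/-- Evaluation of a family of coefficients at `x`, truncated at the multi-index `a`. -/
def evalFamily {n : ℕ} (φ : B →ₐ[k] A) (x : Fin n → A) (a : Fin n → ℕ)
    (f : (Fin n → ℕ) → B) : A :=
  ∑ e ∈ Finset.Iic a, (∏ m, x m ^ e m) * φ (f e)

lemma sum_fin_eq_evalFamily {n : ℕ} (φ : B →ₐ[k] A) (x : Fin n → A) {dv : Fin n → ℕ}
    {a : Fin n → ℕ} (ha : ∀ m, a m + 1 = dv m) (f : (Fin n → ℕ) → B) :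
    ∑ e : (m : Fin n) → Fin (dv m), (∏ m, x m ^ (e m : ℕ)) * φ (f fun m => (e m : ℕ)) =
      evalFamily φ x a f := by
  refine Finset.sum_nbij (fun e m => (e m : ℕ)) ?_ ?_ ?_ ?_
  · intro e _
    rw [Finset.mem_Iic]
    intro m
    have := (e m).2
    have := ha m
    show (e m : ℕ) ≤ a m
    omega
  · intro e _ e' _ h
    ext m
    exact congrFun h m
  · intro e he
    have he' : e ≤ a := by simpa using he
    refine ⟨fun m => ⟨e m, ?_⟩, by simp, rfl⟩
    rw [← ha m]
    exact Nat.lt_succ_of_le (he' m)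
  · intro e _
    rfl

lemma prod_pow_add_single {n : ℕ} (x : Fin n → A) (e : Fin n → ℕ) (m : Fin n) :
    ∏ j, x j ^ (e + Pi.single m 1 : Fin n → ℕ) j = x m * ∏ j, x j ^ e j := by
  simp only [Pi.add_apply, pow_add, Finset.prod_mul_distrib]
  rw [mul_comm]
  congr 1
  rw [Finset.prod_eq_single m]
  · simp
  · intro j _ hj
    simp [hj]
  · simp

lemma sub_single_add_single {ι : Type*} [DecidableEq ι] {e : ι → ℕ} {m : ι} (h : e m ≠ 0) :
    e - Pi.single m 1 + Pi.single m 1 = e := by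
  ext j
  by_cases hj : j = m
  · subst hj; simp; omega
  · simp [hj]

lemma evalFamily_shift {n : ℕ} (φ : B →ₐ[k] A) (x : Fin n → A) {a : Fin n → ℕ} (m : Fin n)
    (hx : x m ^ (a m + 1) = 0) (f : (Fin n → ℕ) → B) :
    evalFamily φ x a (shiftOp k B m f) = x m * evalFamily φ x a f := by
  unfold evalFamily
  rw [Finset.mul_sum]
  have h1 : ∑ e ∈ Finset.Iic a, (∏ j, x j ^ e j) * φ (shiftOp k B m f e) =
      ∑ e ∈ (Finset.Iic a).filter (fun e => e m ≠ 0),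
        (∏ j, x j ^ e j) * φ (f (e - Pi.single m 1)) := by
    rw [Finset.sum_filter]
    refine Finset.sum_congr rfl fun e _ => ?_
    by_cases h : e m = 0 <;> simp [shiftOp_apply, h]
  have h2 : ∑ e ∈ Finset.Iic a, x m * ((∏ j, x j ^ e j) * φ (f e)) =
      ∑ e ∈ (Finset.Iic a).filter (fun e => e m ≠ a m),
        x m * ((∏ j, x j ^ e j) * φ (f e)) := by
    rw [Finset.sum_filter]
    refine Finset.sum_congr rfl fun e _ => ?_
    by_cases h : e m = a m
    · rw [if_neg (by simpa using h), ← mul_assoc, ← Finset.mul_prod_erase _ _ (Finset.mem_univ m),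
        ← mul_assoc, ← pow_succ', h, hx]
      simp
    · rw [if_pos h]
  rw [h1, h2]
  refine Finset.sum_nbij' (fun e => e - Pi.single m 1) (fun e => e + Pi.single m 1) ?_ ?_ ?_ ?_ ?_
  · intro e he
    simp only [Finset.mem_filter, Finset.mem_Iic] at he ⊢
    refine ⟨tsub_le_self.trans he.1, ?_⟩
    have : e m ≤ a m := he.1 m
    simp only [Pi.sub_apply, Pi.single_eq_same]
    omega
  · intro e he
    simp only [Finset.mem_filter, Finset.mem_Iic] at he ⊢
    refine ⟨fun j => ?_, by simp⟩
    have : e j ≤ a j := he.1 j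
    by_cases hj : j = m
    · subst hj
      simp only [Pi.add_apply, Pi.single_eq_same]
      omega
    · simpa [hj] using this
  · intro e he
    simp only [Finset.mem_filter] at he
    exact sub_single_add_single he.2
  · intro e _
    simp
  · intro e he
    simp only [Finset.mem_filter] at he
    rw [← mul_assoc, ← prod_pow_add_single, sub_single_add_single he.2]

lemma evalFamily_extOp_pow {n : ℕ} (φ : B →ₐ[k] A) (x : Fin n → A) {a : Fin n → ℕ}
    (hx : ∀ m, x m ^ (a m + 1) = 0) (ℓ : B) (t : ℕ) (f : (Fin n → ℕ) → B) :
    evalFamily φ x a ((extOp (LinearMap.mulLeft k ℓ) ^ t) f) =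
      (φ ℓ + ∑ m, x m) ^ t * evalFamily φ x a f := by
  induction t with
  | zero => simp
  | succ t ih =>
    rw [extOp_pow_succ_apply, pow_succ', mul_assoc, ← ih, add_mul, Finset.sum_mul,
      ← Finset.sum_congr rfl fun m _ => evalFamily_shift φ x m (hx m) _]
    generalize (extOp (LinearMap.mulLeft k ℓ) ^ t) f = g
    simp only [evalFamily, extOp, LinearMap.add_apply, LinearMap.sum_apply, Pi.add_apply,
      Finset.sum_apply, map_add, map_sum, mul_add, Finset.sum_add_distrib, Finset.mul_sum]
    rw [Finset.sum_comm (s := Finset.Iic a)]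
    congr 1
    refine Finset.sum_congr rfl fun e _ => ?_
    simp [mul_left_comm]

variable {𝒜 : ℤ → Submodule k B} {ℬ : ℤ → Submodule k A} {n : ℕ} {φ : B →ₐ[k] A}
  {x : Fin n → A} {dv : Fin n → ℕ}

lemma extOp_pow_mem (hB : IsStdGradedArtinian k B 𝒜) {ℓ : B} (hℓ : ℓ ∈ 𝒜 1) {a : Fin n → ℕ}
    {i : ℤ} {f : (Fin n → ℕ) → B} (hf : ∀ e ≤ a, f e ∈ 𝒜 (i - ∑ m, (e m : ℤ))) (t : ℕ) :
    ∀ e ≤ a, (extOp (LinearMap.mulLeft k ℓ) ^ t) f e ∈ 𝒜 (i + t - ∑ m, (e m : ℤ)) := by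
  induction t with
  | zero => simpa using hf
  | succ t ih =>
    intro e he
    rw [extOp_pow_succ_apply, extOp_apply]
    refine add_mem ?_ (sum_mem fun m _ => ?_)
    · have := hB.mul_mem hℓ (ih e he)
      rw [LinearMap.mulLeft_apply]
      convert this using 2
      push_cast
      ring
    · split_ifs with h
      · exact zero_mem _
      · have := ih (e - Pi.single m 1) (tsub_le_self.trans he)
        convert this using 2
        have h' : ∑ j, (e j : ℤ) = ∑ j, ((e - Pi.single m 1 : Fin n → ℕ) j : ℤ) + 1 := by
          conv_lhs => rw [← sub_single_add_single h]
          simp [Finset.sum_add_distrib, Pi.single_apply]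
        rw [h']
        push_cast
        ring

lemma IsMultiCIExtension.mulInjOn [CharZero k] (hB : IsStdGradedArtinian k B 𝒜)
    (hA : IsMultiCIExtension 𝒜 ℬ φ x dv) {a : Fin n → ℕ} (ha : ∀ m, a m + 1 = dv m)
    {ℓ : B} (hℓ : ℓ ∈ 𝒜 1) {N : ℤ} (hN : CenteredAt 𝒜 ℓ N) (i : ℤ) (t : ℕ)
    (hi : 2 * i + t ≤ N + ∑ m, (a m : ℤ)) :
    MulInjOn (ℬ i) ((φ ℓ + ∑ m, x m) ^ t) := by
  intro c hc hc0
  obtain ⟨f₀, hf₀, rfl⟩ := hA.decomp_exists i c hc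
  set f : (Fin n → ℕ) → B := fun e =>
    if h : ∀ m, e m < dv m then f₀ fun m => ⟨e m, h m⟩ else 0 with hfdef
  have hf₀f : ∀ e : (m : Fin n) → Fin (dv m), f₀ e = f fun m => (e m : ℕ) := by
    intro e
    simp [hfdef]
  have hx : ∀ m, x m ^ (a m + 1) = 0 := fun m => by rw [ha m]; exact hA.x_pow m
  have hlt : ∀ e ≤ a, ∀ m, e m < dv m := fun e he m => by
    rw [← ha m]
    exact Nat.lt_succ_of_le (he m)
  have hf : ∀ e ≤ a, f e ∈ 𝒜 (i - ∑ m, (e m : ℤ)) := by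
    intro e he
    simpa [hf₀f] using hf₀ fun m => ⟨e m, hlt e he m⟩
  simp only [hf₀f] at hc0 ⊢
  rw [sum_fin_eq_evalFamily φ x ha, ← evalFamily_extOp_pow φ x hx, ← sum_fin_eq_evalFamily φ x ha]
    at hc0
  have hmem := extOp_pow_mem hB hℓ hf t
  have hzero := hA.decomp_unique (i + t)
    (fun e => (extOp (LinearMap.mulLeft k ℓ) ^ t) f fun m => (e m : ℕ))
    (fun e => hmem _ fun m => by have := (e m).2; have := ha m; show (e m : ℕ) ≤ a m; omega) hc0
  have hinj : InjBelow (LinearMap.mulLeft k ℓ) 𝒜 N := by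
    intro i t hit v hv h0
    rw [LinearMap.pow_mulLeft, LinearMap.mulLeft_apply] at h0
    exact hN.1 i t hit v hv h0
  have hv := hinj.vanishesUpTo a i t f hi hf
    (fun e he => hzero fun m => ⟨e m, hlt e he m⟩)
  rw [sum_fin_eq_evalFamily φ x ha]
  refine Finset.sum_eq_zero fun e he => ?_
  rw [hv e (Finset.mem_Iic.1 he), map_zero, mul_zero]

lemma IsMultiCIExtension.mulSurjOnto [CharZero k] (hB : IsStdGradedArtinian k B 𝒜)
    (hℬ : IsStdGradedArtinian k A ℬ)
    (hA : IsMultiCIExtension 𝒜 ℬ φ x dv) {a : Fin n → ℕ} (ha : ∀ m, a m + 1 = dv m)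
    {ℓ : B} (hℓ : ℓ ∈ 𝒜 1) {N : ℤ} (hN : CenteredAt 𝒜 ℓ N) (i : ℤ) (t : ℕ)
    (hi : N + ∑ m, (a m : ℤ) < 2 * i + t) :
    MulSurjOnto (ℬ i) (ℬ (i + t)) ((φ ℓ + ∑ m, x m) ^ t) := by
  set y := φ ℓ + ∑ m, x m with hy
  have hyt : y ^ t ∈ ℬ t := by
    have hy1 : y ∈ ℬ 1 := add_mem (hA.map_mem 1 ℓ hℓ) (sum_mem fun m _ => hA.x_mem m)
    clear hi
    induction t with
    | zero => simpa using hℬ.one_mem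
    | succ t ih =>
      rw [pow_succ]
      simpa using hℬ.mul_mem ih hy1
  set j := i + (t : ℤ) with hj
  have hind := hℬ.internal.submodule_iSupIndep
  have htop := hℬ.internal.submodule_iSup_eq_top
  have htopB := hB.internal.submodule_iSup_eq_top
  intro w hw
  set W : Submodule k A := (ℬ i).map (LinearMap.mulLeft k (y ^ t)) ⊔ ⨆ (j') (_ : j' ≠ j), ℬ j'
    with hW
  suffices hwW : w ∈ W by
    obtain ⟨u, hu, r, hr, rfl⟩ := Submodule.mem_sup.1 hwW
    obtain ⟨v, hv, rfl⟩ := hu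
    refine ⟨v, hv, ?_⟩
    have hvj : y ^ t * v ∈ ℬ j := by
      have := hℬ.mul_mem hyt hv
      rwa [add_comm] at this
    have hrj : r ∈ ℬ j := by
      have := sub_mem hw hvj
      simpa using this
    have hr0 : r = 0 := by
      simpa using (Submodule.disjoint_def.1 (hind j)) r hrj hr
    simp [hr0]
  by_contra hwW
  obtain ⟨lam, hlamw, hlamW⟩ := Submodule.exists_le_ker_of_notMem hwW
  have hoff : ∀ j' ≠ j, ∀ c ∈ ℬ j', lam c = 0 := fun j' hj' c hc =>
    hlamW (Submodule.mem_sup_right (Submodule.mem_iSup_of_mem j' (Submodule.mem_iSup_of_mem hj' hc)))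
  have hy0 : ∀ c, lam (y ^ t * c) = 0 := by
    intro c
    have hc : c ∈ ⨆ i, ℬ i := by rw [htop]; trivial
    induction hc using Submodule.iSup_induction' with
    | mem i' c hc =>
      by_cases h : i' = i
      · subst h
        exact hlamW (Submodule.mem_sup_left ⟨c, hc, rfl⟩)
      · refine hoff _ ?_ _ (hℬ.mul_mem hyt hc)
        omega
    | zero => simp
    | add c c' _ _ h h' => rw [mul_add, map_add, h, h', add_zero]
  have hx : ∀ m, x m ^ (a m + 1) = 0 := fun m => by rw [ha m]; exact hA.x_pow m
  have hmon : ∀ (e : Fin n → ℕ), e ≤ a → ∀ j', ∀ b ∈ 𝒜 j',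
      (∏ m, x m ^ e m) * φ b ∈ ℬ (j' + ∑ m, (e m : ℤ)) := by
    intro e he j' b hb
    have hlt : ∀ m, e m < dv m := fun m => by
      rw [← ha m]
      exact Nat.lt_succ_of_le (he m)
    have := hA.decomp_mem (j' + ∑ m, (e m : ℤ))
      (Pi.single (fun m => ⟨e m, hlt m⟩) b) (by
        intro e'
        by_cases h : e' = fun m => ⟨e m, hlt m⟩
        · subst h
          simpa using hb
        · simp [h])
    rw [Finset.sum_eq_single (fun m => ⟨e m, hlt m⟩)] at this
    · simpa using this
    · intro e' _ h
      simp [h]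
    · simp
  set g : ℕ → (Fin n → ℕ) → Module.Dual k B := fun s e =>
    lam ∘ₗ LinearMap.mulLeft k (y ^ s * ∏ m, x m ^ (a m - e m)) ∘ₗ φ.toLinearMap with hg
  have hgs : ∀ s e b, g s e b = lam (y ^ s * (∏ m, x m ^ (a m - e m)) * φ b) := fun _ _ _ => rfl
  set L : Module.End k (Module.Dual k B) := (LinearMap.mulLeft k ℓ).dualMap with hL
  have hLapp : ∀ (μ : Module.Dual k B) b, L μ b = μ (ℓ * b) := fun _ _ => rfl
  have hstep : ∀ s, ∀ e ≤ a, (extOp L ^ s) (g 0) e = g s e := by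
    intro s
    induction s with
    | zero => intro e _; rfl
    | succ s ih =>
      intro e he
      rw [extOp_pow_succ_apply, extOp_apply, ih e he]
      ext b
      rw [LinearMap.add_apply, hLapp, hgs, hgs, pow_succ]
      have hterm : ∀ m, (if e m = 0 then (0 : Module.Dual k B)
          else (extOp L ^ s) (g 0) (e - Pi.single m 1)) b =
            lam (y ^ s * (x m * ∏ m, x m ^ (a m - e m)) * φ b) := by
        intro m
        split_ifs with h
        · rw [← Finset.mul_prod_erase _ _ (Finset.mem_univ m), ← mul_assoc (x m), ← pow_succ', h,
            Nat.sub_zero, hx m]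
          simp
        · rw [ih _ (tsub_le_self.trans he), hgs, ← prod_pow_add_single]
          congr 4
          ext j
          congr 1
          have : e m ≤ a m := he m
          by_cases hjm : j = m
          · subst hjm
            simp only [Pi.sub_apply, Pi.add_apply, Pi.single_eq_same]
            omega
          · simp [hjm]
      rw [LinearMap.sum_apply, Finset.sum_congr rfl fun m _ => hterm m, ← map_sum, ← map_add]
      congr 1
      rw [hy, map_mul, ← Finset.sum_mul, ← Finset.mul_sum, ← Finset.sum_mul]
      ring
  have hinj : InjBelow L
      (fun i => ⨅ (j' : ℤ) (_ : j' ≠ -i), (𝒜 j').dualAnnihilator) (-N - 1) := by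
    intro i' s his μ hμ h0
    have hLs : ∀ b, (L ^ s) μ b = μ (ℓ ^ s * b) := by
      intro b
      clear h0 his
      induction s generalizing b with
      | zero => simp
      | succ s ih => rw [pow_succ', Module.End.mul_apply, hLapp, ih, pow_succ, mul_assoc]
    ext b
    have hb : b ∈ ⨆ i, 𝒜 i := by rw [htopB]; trivial
    induction hb using Submodule.iSup_induction' with
    | mem q b hb =>
      by_cases hq : q = -i'
      · obtain ⟨v, -, rfl⟩ := hN.2 (q - s) s (by linarith) b (by simpa using hb)
        rw [← hLs, h0]
        simp
      · simp only [Submodule.mem_iInf] at hμ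
        exact (Submodule.mem_dualAnnihilator μ).1 (hμ q hq) b hb
    | zero => simp
    | add c c' _ _ h h' => rw [map_add, h, h']; simp
  have hsum : ∀ e ≤ a, ∑ m, ((a m - e m : ℕ) : ℤ) = ∑ m, (a m : ℤ) - ∑ m, (e m : ℤ) := by
    intro e he
    rw [← Finset.sum_sub_distrib]
    exact Finset.sum_congr rfl fun m _ => Nat.cast_sub (he m)
  have hvan := hinj.vanishesUpTo a (∑ m, (a m : ℤ) - j) t (g 0) (by linarith) (by
    intro e he
    simp only [Submodule.mem_iInf]
    intro j' hj'
    rw [Submodule.mem_dualAnnihilator]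
    intro b hb
    rw [hgs, pow_zero, one_mul]
    refine hoff _ ?_ _ (hmon (fun m => a m - e m) (fun m => Nat.sub_le _ _) j' b hb)
    rw [hsum e he]
    intro h
    apply hj'
    linarith) (by
    intro e he
    rw [hstep t e he]
    ext b
    rw [hgs, mul_assoc, hy0]
    rfl)
  apply hlamw
  obtain ⟨f, -, rfl⟩ := hA.decomp_exists j w hw
  rw [map_sum]
  refine Finset.sum_eq_zero fun e _ => ?_
  have h := DFunLike.congr_fun (hvan (fun m => a m - e m) fun m => Nat.sub_le _ _) (f e)
  rw [hgs, pow_zero, one_mul] at h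
  have hsub : ∀ m, a m - (a m - (e m : ℕ)) = e m := fun m => by
    have := (e m).2
    have := ha m
    omega
  simpa [hsub] using h

end Extension
section Hilbert

variable {k B : Type*} [Field k] [CommRing B] [Algebra k B] {𝒜 : ℤ → Submodule k B}

lemma IsStdGradedArtinian.pow_mem (hB : IsStdGradedArtinian k B 𝒜) {i : ℤ} {b : B}
    (hb : b ∈ 𝒜 i) (t : ℕ) : b ^ t ∈ 𝒜 (t * i) := by
  induction t with
  | zero => simpa using hB.one_mem
  | succ t ih =>
    rw [pow_succ]
    convert hB.mul_mem ih hb using 2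
    push_cast
    ring

lemma IsStdGradedArtinian.pow_mul_mem (hB : IsStdGradedArtinian k B 𝒜) {ℓ : B}
    (hℓ : ℓ ∈ 𝒜 1) {i j : ℤ} (t : ℕ) (hij : i + t = j) {v : B} (hv : v ∈ 𝒜 i) :
    ℓ ^ t * v ∈ 𝒜 j := by
  subst hij
  have := hB.mul_mem (hB.pow_mem hℓ t) hv
  rwa [mul_one, add_comm] at this

lemma hilb_le_of_mulInjOn [FiniteDimensional k B] {i j : ℤ} {a : B}
    (hmem : ∀ v ∈ 𝒜 i, a * v ∈ 𝒜 j) (h : MulInjOn (𝒜 i) a) : hilb 𝒜 i ≤ hilb 𝒜 j := by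
  refine LinearMap.finrank_le_finrank_of_injective
    (f := (LinearMap.mulLeft k a).restrict hmem) ?_
  rw [← LinearMap.ker_eq_bot, LinearMap.ker_eq_bot']
  intro v hv
  exact Subtype.ext (h v v.2 (congrArg Subtype.val hv))

lemma hilb_le_of_mulSurjOnto [FiniteDimensional k B] {i j : ℤ} {a : B}
    (hmem : ∀ v ∈ 𝒜 i, a * v ∈ 𝒜 j) (h : MulSurjOnto (𝒜 i) (𝒜 j) a) :
    hilb 𝒜 j ≤ hilb 𝒜 i := by
  refine LinearMap.finrank_le_finrank_of_surjective
    (f := (LinearMap.mulLeft k a).restrict hmem) ?_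
  intro w
  obtain ⟨v, hv, hvw⟩ := h w w.2
  exact ⟨⟨v, hv⟩, Subtype.ext hvw⟩

lemma MulInjOn.surjOnto_of_hilb_le [FiniteDimensional k B] {i j : ℤ} {a : B}
    (hmem : ∀ v ∈ 𝒜 i, a * v ∈ 𝒜 j) (h : MulInjOn (𝒜 i) a) (hij : hilb 𝒜 j ≤ hilb 𝒜 i) :
    MulSurjOnto (𝒜 i) (𝒜 j) a := by
  have heq : hilb 𝒜 i = hilb 𝒜 j := le_antisymm (hilb_le_of_mulInjOn hmem h) hij
  have hinj : Function.Injective ((LinearMap.mulLeft k a).restrict hmem) := by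
    rw [← LinearMap.ker_eq_bot, LinearMap.ker_eq_bot']
    intro v hv
    exact Subtype.ext (h v v.2 (congrArg Subtype.val hv))
  intro w hw
  obtain ⟨v, hv⟩ := (LinearMap.injective_iff_surjective_of_finrank_eq_finrank heq).1 hinj ⟨w, hw⟩
  exact ⟨v, v.2, congrArg Subtype.val hv⟩

lemma MulSurjOnto.injOn_of_hilb_le [FiniteDimensional k B] {i j : ℤ} {a : B}
    (hmem : ∀ v ∈ 𝒜 i, a * v ∈ 𝒜 j) (h : MulSurjOnto (𝒜 i) (𝒜 j) a)
    (hij : hilb 𝒜 i ≤ hilb 𝒜 j) : MulInjOn (𝒜 i) a := by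
  have heq : hilb 𝒜 i = hilb 𝒜 j := le_antisymm hij (hilb_le_of_mulSurjOnto hmem h)
  have hsurj : Function.Surjective ((LinearMap.mulLeft k a).restrict hmem) := by
    intro w
    obtain ⟨v, hv, hvw⟩ := h w w.2
    exact ⟨⟨v, hv⟩, Subtype.ext hvw⟩
  intro v hv hv0
  have := (LinearMap.injective_iff_surjective_of_finrank_eq_finrank heq).2 hsurj
    (a₁ := ⟨v, hv⟩) (a₂ := 0) (by rw [map_zero]; exact Subtype.ext hv0)
  exact congrArg Subtype.val this

lemma IsStdGradedArtinian.hilb_neg (hB : IsStdGradedArtinian k B 𝒜) {i : ℤ} (hi : i < 0) :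
    hilb 𝒜 i = 0 := by
  rw [hilb, hB.neg_bot i hi, finrank_bot]

lemma IsStdGradedArtinian.exists_hilb_eq_zero (hB : IsStdGradedArtinian k B 𝒜) :
    ∀ n : ℤ, ∃ D, n < D ∧ hilb 𝒜 D = 0 := by
  intro n
  have := hB.finiteDim
  have hfin : {i | 𝒜 i ≠ ⊥}.Finite :=
    WellFoundedGT.finite_ne_bot_of_iSupIndep hB.internal.submodule_iSupIndep
  obtain ⟨D, hD, hD'⟩ := (Set.Ioi_infinite n).exists_notMem_finite hfin
  refine ⟨D, hD, ?_⟩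
  rw [hilb, show 𝒜 D = ⊥ by simpa using hD', finrank_bot]

/-- A strong Lefschetz element acts with full rank on all pieces, including negative ones. -/
lemma IsStdGradedArtinian.mulFullRank (hB : IsStdGradedArtinian k B 𝒜) {ℓ : B}
    (h : ∀ i : ℤ, 0 ≤ i → ∀ t : ℕ, 1 ≤ t → MulFullRank (𝒜 i) (𝒜 (i + t)) (ℓ ^ t))
    (i : ℤ) (t : ℕ) : MulFullRank (𝒜 i) (𝒜 (i + t)) (ℓ ^ t) := by
  rcases lt_or_ge i 0 with hi | hi
  · left
    intro v hv _
    rw [hB.neg_bot i hi] at hv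
    simpa using hv
  · rcases Nat.eq_zero_or_pos t with rfl | ht
    · left
      intro v _ hv
      simpa using hv
    · exact h i hi t ht

/-- Under the strong Lefschetz property, the Hilbert function has no strict valley. -/
lemma IsStdGradedArtinian.hilb_unimodal (hB : IsStdGradedArtinian k B 𝒜) {ℓ : B}
    (hℓ : ℓ ∈ 𝒜 1) (h : ∀ (i : ℤ) (t : ℕ), MulFullRank (𝒜 i) (𝒜 (i + t)) (ℓ ^ t))
    {a b c : ℤ} (hab : a ≤ b) (hbc : b ≤ c) :
    hilb 𝒜 a ≤ hilb 𝒜 b ∨ hilb 𝒜 c ≤ hilb 𝒜 b := by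
  have := hB.finiteDim
  obtain ⟨s, rfl⟩ := Int.le.dest hab
  obtain ⟨t, rfl⟩ := Int.le.dest hbc
  have hst : a + ((s + t : ℕ) : ℤ) = a + s + t := by push_cast; ring
  rcases h a (s + t) with h | h
  · left
    refine hilb_le_of_mulInjOn (fun v hv => hB.pow_mul_mem hℓ s rfl hv) ?_
    intro v hv hv0
    refine h v hv ?_
    rw [add_comm, pow_add, mul_assoc, hv0, mul_zero]
  · right
    refine hilb_le_of_mulSurjOnto (fun v hv => hB.pow_mul_mem hℓ t rfl hv) ?_
    rw [hst] at h
    intro w hw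
    obtain ⟨v, hv, rfl⟩ := h w hw
    exact ⟨ℓ ^ s * v, hB.pow_mul_mem hℓ s rfl hv, by rw [add_comm, pow_add, mul_assoc]⟩

/-- An almost centered Hilbert function without strict valleys has a centre. -/
lemma exists_centre {h : ℤ → ℕ} (hneg : ∀ i < 0, h i = 0) (hD : ∀ n : ℤ, ∃ D, n < D ∧ h D = 0)
    (huni : ∀ a b c : ℤ, a ≤ b → b ≤ c → h a ≤ h b ∨ h c ≤ h b)
    (hac : ∀ i j : ℤ, i < j → (h i < h j → ∀ s : ℕ, h (i - s) ≤ h (j + s)) ∧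
      (h j < h i → ∀ s : ℕ, h (j + s) ≤ h (i - s))) :
    ∃ N : ℤ, ∀ i j : ℤ, i ≤ j → (i + j ≤ N → h i ≤ h j) ∧ (N < i + j → h j ≤ h i) := by
  by_cases hup : ∃ i j : ℤ, i < j ∧ h i < h j
  swap
  · push Not at hup
    have hall : ∀ j, h j = 0 := by
      intro j
      have := hneg (min j 0 - 1) (by omega)
      have := hup (min j 0 - 1) j (by omega)
      omega
    exact ⟨0, fun i j _ => by simp [hall]⟩
  have key : ∀ i j i' j' : ℤ, i < j → i' < j' → h i < h j → h j' < h i' → i + j < i' + j' := by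
    intro i j i' j' hij hij' hup hdown
    by_contra! hle
    rcases le_or_gt i i' with hii | hii
    · have h1 := (hac i' j' hij').2 hdown (i' - i).toNat
      rw [Int.toNat_of_nonneg (by omega)] at h1
      rw [show i' - (i' - i) = i by ring] at h1
      rcases huni i' j' j hij'.le (by omega) with h2 | h2
      · omega
      · rcases huni j' (j' + (i' - i)) j (by omega) (by omega) with h3 | h3 <;> omega
    · have h1 := (hac i j hij).1 hup (i - i').toNat
      rw [Int.toNat_of_nonneg (by omega)] at h1
      rw [show i - (i - i') = i' by ring] at h1
      rcases huni i' j' (j + (i - i')) hij'.le (by omega) with h2 | h2 <;> omega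
  obtain ⟨i₀, j₀, hij₀, hlt₀⟩ := hup
  obtain ⟨D, hjD, hD⟩ := hD j₀
  obtain ⟨N, ⟨a, b, hab, hlt, hN⟩, hmax⟩ := Int.exists_greatest_of_bdd
    (P := fun m => ∃ i j : ℤ, i < j ∧ h i < h j ∧ i + j = m)
    ⟨j₀ + D, fun m ⟨i, j, hij, hlt, hm⟩ => by
      have := key i j j₀ D hij hjD hlt (by omega)
      omega⟩
    ⟨i₀ + j₀, i₀, j₀, hij₀, hlt₀, rfl⟩
  refine ⟨N, fun i j hij => ⟨fun hle => ?_, fun hlt' => ?_⟩⟩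
  · by_contra! hji
    have hne : i ≠ j := by rintro rfl; omega
    have := key a b i j hab (by omega) hlt hji
    omega
  · by_contra! hji
    have hne : i ≠ j := by rintro rfl; omega
    have := hmax (i + j) ⟨i, j, by omega, hji, rfl⟩
    omega

/-- An almost centered algebra with the strong Lefschetz property has a centre. -/
lemma IsStdGradedArtinian.exists_centeredAt (hB : IsStdGradedArtinian k B 𝒜)
    (hac : AlmostCentered 𝒜) {ℓ : B} (hℓ : ℓ ∈ 𝒜 1)
    (h : ∀ i : ℤ, 0 ≤ i → ∀ t : ℕ, 1 ≤ t → MulFullRank (𝒜 i) (𝒜 (i + t)) (ℓ ^ t)) :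
    ∃ N, CenteredAt 𝒜 ℓ N := by
  have := hB.finiteDim
  have hfull := hB.mulFullRank h
  obtain ⟨N, hN⟩ := exists_centre (h := hilb 𝒜) (fun i hi => hB.hilb_neg hi)
    hB.exists_hilb_eq_zero (fun a b c hab hbc => hB.hilb_unimodal hℓ hfull hab hbc) hac
  have hmem : ∀ (i : ℤ) (t : ℕ), ∀ v ∈ 𝒜 i, ℓ ^ t * v ∈ 𝒜 (i + t) :=
    fun i t v hv => hB.pow_mul_mem hℓ t rfl hv
  refine ⟨N, fun i t hit => ?_, fun i t hit => ?_⟩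
  · rcases hfull i t with h1 | h1
    · exact h1
    · exact h1.injOn_of_hilb_le (hmem i t) ((hN i (i + t) (by omega)).1 (by omega))
  · rcases hfull i t with h1 | h1
    · exact h1.surjOnto_of_hilb_le (hmem i t) ((hN i (i + t) (by omega)).2 (by omega))
    · exact h1

end Hilbert
section CommRingIdentities

variable {R : Type*} [CommRing R]

/-- The homogeneous form of the truncation of `(1 - z)⁻ᵗ` in degree `s`. -/
lemma sub_pow_mul_multichoose_sum {l z : R} {s : ℕ} (hz : z ^ (s + 1) = 0) (t : ℕ) :
    (l - z) ^ t * ∑ q ∈ Finset.range (s + 1), (t.multichoose q : R) * (z ^ q * l ^ (s - q)) =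
      l ^ (t + s) := by
  induction t with
  | zero =>
    rw [Finset.sum_range_succ']
    simp
  | succ t ih =>
    have hstep : (l - z) * ∑ q ∈ Finset.range (s + 1),
        ((t + 1).multichoose q : R) * (z ^ q * l ^ (s - q)) =
        l * ∑ q ∈ Finset.range (s + 1), (t.multichoose q : R) * (z ^ q * l ^ (s - q)) := by
      have h1 : z * ∑ q ∈ Finset.range (s + 1),
          ((t + 1).multichoose q : R) * (z ^ q * l ^ (s - q)) =
          ∑ q ∈ Finset.range s, ((t + 1).multichoose q : R) * (z ^ (q + 1) * l ^ (s - q)) := by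
        rw [Finset.sum_range_succ, mul_add, Finset.mul_sum]
        have : z * (((t + 1).multichoose s : R) * (z ^ s * l ^ (s - s))) = 0 := by
          linear_combination ((t + 1).multichoose s : R) * l ^ (s - s) * hz
        rw [this, add_zero]
        refine Finset.sum_congr rfl fun q _ => ?_
        ring
      rw [sub_mul, h1, Finset.sum_range_succ', Finset.sum_range_succ' _ s, mul_add, mul_add,
        Finset.mul_sum, Finset.mul_sum, add_sub_right_comm, ← Finset.sum_sub_distrib]
      congr 1
      · refine Finset.sum_congr rfl fun q hq => ?_
        obtain ⟨r, hr⟩ : ∃ r, s = q + 1 + r :=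
          Nat.exists_eq_add_of_le (Finset.mem_range.1 hq)
        rw [show s - q = r + 1 by omega, show s - (q + 1) = r by omega,
          Nat.multichoose_succ_succ]
        push_cast
        ring
      · simp
    rw [pow_succ, mul_assoc, hstep, mul_left_comm, ih]
    ring

lemma sub_pow_eq_pow_mul_sum {l z : R} {s : ℕ} (hz : z ^ (s + 1) = 0) (r : ℕ) :
    (l - z) ^ (r + s) =
      l ^ r * ∑ q ∈ Finset.range (s + 1), ((r + s).choose q : R) * ((-z) ^ q * l ^ (s - q)) := by
  rw [sub_eq_add_neg, add_comm, add_pow, Finset.mul_sum,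
    ← Finset.sum_subset (s₁ := Finset.range (s + 1))]
  · refine Finset.sum_congr rfl fun q hq => ?_
    have : q ≤ s := Nat.lt_succ_iff.1 (Finset.mem_range.1 hq)
    rw [Nat.add_sub_assoc this, pow_add]
    ring
  · intro q hq
    simp only [Finset.mem_range] at hq ⊢
    omega
  · intro q _ hq
    obtain ⟨u, rfl⟩ : ∃ u, q = s + 1 + u :=
      Nat.exists_eq_add_of_le (by simpa using hq)
    rw [neg_pow, pow_add z, hz]
    simp

end CommRingIdentities

section Truncation

open Polynomial

/-- The extension `B[X]/(X ^ d)`. -/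
abbrev TruncPoly (B : Type*) [CommRing B] (d : ℕ) : Type _ :=
  B[X] ⧸ (Ideal.span {(X : B[X]) ^ d})

variable {k B : Type*} [Field k] [CommRing B] [Algebra k B]

/-- Polynomials that are homogeneous of total degree `j`. -/
def polyGrading (𝒜 : ℤ → Submodule k B) (j : ℤ) : Submodule k B[X] where
  carrier := {p | ∀ q : ℕ, p.coeff q ∈ 𝒜 (j - q)}
  add_mem' hp hp' q := by rw [coeff_add]; exact add_mem (hp q) (hp' q)
  zero_mem' q := by rw [coeff_zero]; exact zero_mem _
  smul_mem' c p hp q := by rw [coeff_smul]; exact Submodule.smul_mem _ _ (hp q)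

/-- The quotient map onto `B[X]/(X ^ d)`. -/
noncomputable abbrev truncMk (k : Type*) {B : Type*} [Field k] [CommRing B] [Algebra k B] (d : ℕ) :
    B[X] →ₐ[k] TruncPoly B d :=
  Ideal.Quotient.mkₐ k _

/-- The grading of `B[X]/(X ^ d)` by total degree. -/
noncomputable def truncGrading (𝒜 : ℤ → Submodule k B) (d : ℕ) (j : ℤ) :
    Submodule k (TruncPoly B d) :=
  (polyGrading 𝒜 j).map (truncMk k d).toLinearMap

/-- The inclusion of `B` into `B[X]/(X ^ d)`. -/
noncomputable def truncInc (k : Type*) {B : Type*} [Field k] [CommRing B] [Algebra k B] (d : ℕ) :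
    B →ₐ[k] TruncPoly B d :=
  (truncMk k d).comp CAlgHom

/-- The coefficient of `X ^ q` of an element of `B[X]/(X ^ d)`, for `q < d`. -/
noncomputable def truncCoeff (k : Type*) {B : Type*} [Field k] [CommRing B] [Algebra k B] {d : ℕ}
    (q : ℕ) (hq : q < d) : TruncPoly B d →ₗ[k] B :=
  (((Ideal.span {(X : B[X]) ^ d}).restrictScalars k).liftQ
    ((lcoeff B q).restrictScalars k) (by
      intro p hp
      have hp' : (X : B[X]) ^ d ∣ p := Ideal.mem_span_singleton.1 hp
      exact X_pow_dvd_iff.1 hp' q hq)) ∘ₗ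
    (Submodule.Quotient.restrictScalarsEquiv k (Ideal.span {(X : B[X]) ^ d})).symm.toLinearMap

lemma truncCoeff_mk {d q : ℕ} (hq : q < d) (p : B[X]) :
    truncCoeff k q hq (truncMk k d p) = p.coeff q := rfl

lemma truncInc_apply {d : ℕ} (b : B) : truncInc k d b = truncMk k d (C b) := rfl

lemma truncMk_surjective {d : ℕ} : Function.Surjective (truncMk k (B := B) d) :=
  Ideal.Quotient.mkₐ_surjective k _

lemma truncCoeff_inc_mul {d q : ℕ} (hq : q < d) (b : B) (c : TruncPoly B d) :
    truncCoeff k q hq (truncInc k d b * c) = b * truncCoeff k q hq c := by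
  obtain ⟨p, rfl⟩ := truncMk_surjective (k := k) c
  rw [truncInc_apply, ← map_mul, truncCoeff_mk, truncCoeff_mk, coeff_C_mul]

lemma truncCoeff_X_pow_mul_inc {d q : ℕ} (hq : q < d) (r : ℕ) (b : B) :
    truncCoeff k q hq (truncMk k d X ^ r * truncInc k d b) = if r = q then b else 0 := by
  rw [truncInc_apply, ← map_pow, ← map_mul, truncCoeff_mk, coeff_mul_C, coeff_X_pow]
  by_cases h : r = q
  · simp [h]
  · simp [h, Ne.symm h]

lemma truncMk_X_pow (d : ℕ) : truncMk k (B := B) d X ^ d = 0 := by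
  rw [← map_pow]
  exact Ideal.Quotient.eq_zero_iff_mem.2 (Ideal.mem_span_singleton_self _)

variable {𝒜 : ℤ → Submodule k B}

lemma monomial_mem_polyGrading {j : ℤ} {q : ℕ} {b : B} (hb : b ∈ 𝒜 (j - q)) :
    monomial q b ∈ polyGrading 𝒜 j := by
  intro r
  rw [coeff_monomial]
  split_ifs with h
  · subst h; exact hb
  · exact zero_mem _

lemma C_mem_polyGrading {j : ℤ} {b : B} (hb : b ∈ 𝒜 j) : C b ∈ polyGrading 𝒜 j :=
  monomial_mem_polyGrading (by simpa using hb)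

lemma IsStdGradedArtinian.X_mem_polyGrading (hB : IsStdGradedArtinian k B 𝒜) :
    X ∈ polyGrading 𝒜 1 :=
  monomial_mem_polyGrading (by simpa using hB.one_mem)

lemma IsStdGradedArtinian.mul_mem_polyGrading (hB : IsStdGradedArtinian k B 𝒜) {i j : ℤ}
    {p p' : B[X]} (hp : p ∈ polyGrading 𝒜 i) (hp' : p' ∈ polyGrading 𝒜 j) :
    p * p' ∈ polyGrading 𝒜 (i + j) := by
  intro q
  rw [coeff_mul]
  refine sum_mem fun r hr => ?_
  have hr' : r.1 + r.2 = q := Finset.HasAntidiagonal.mem_antidiagonal.1 hr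
  convert hB.mul_mem (hp r.1) (hp' r.2) using 2
  rw [← hr']
  push_cast
  ring

lemma truncCoeff_mem {d q : ℕ} (hq : q < d) {j : ℤ} {c : TruncPoly B d}
    (hc : c ∈ truncGrading 𝒜 d j) : truncCoeff k q hq c ∈ 𝒜 (j - q) := by
  obtain ⟨p, hp, rfl⟩ := hc
  exact hp q

lemma truncMk_mem {d : ℕ} {j : ℤ} {p : B[X]} (hp : p ∈ polyGrading 𝒜 j) :
    truncMk k d p ∈ truncGrading 𝒜 d j := ⟨p, hp, rfl⟩

lemma eq_zero_of_truncCoeff {d : ℕ} {c : TruncPoly B d}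
    (hc : ∀ q (hq : q < d), truncCoeff k q hq c = 0) : c = 0 := by
  obtain ⟨p, rfl⟩ := truncMk_surjective (k := k) c
  exact Ideal.Quotient.eq_zero_iff_mem.2 (Ideal.mem_span_singleton.2 (X_pow_dvd_iff.2 hc))

lemma IsStdGradedArtinian.truncGrading_succ_le (hB : IsStdGradedArtinian k B 𝒜) (d : ℕ) {i : ℤ}
    (hi : 0 ≤ i) : truncGrading 𝒜 d (i + 1) ≤ truncGrading 𝒜 d 1 * truncGrading 𝒜 d i := by
  rintro _ ⟨p, hp, rfl⟩
  rw [p.as_sum_support, map_sum]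
  refine sum_mem fun q _ => ?_
  generalize hb : p.coeff q = b
  have hpq : b ∈ 𝒜 (i + 1 - q) := hb ▸ hp q
  cases q with
  | zero =>
    have h : b ∈ 𝒜 1 * 𝒜 i := by
      rw [← hB.succ_eq i hi]
      simpa using hpq
    clear hb hpq
    induction h using Submodule.mul_induction_on' with
    | mem_mul_mem u hu v hv =>
      have := Submodule.mul_mem_mul (truncMk_mem (d := d) (C_mem_polyGrading hu))
        (truncMk_mem (d := d) (C_mem_polyGrading hv))
      rw [← map_mul, ← C_mul] at this
      exact this
    | add u _ v _ hu hv =>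
      rw [map_add, map_add]
      exact add_mem hu hv
  | succ q =>
    have := Submodule.mul_mem_mul (truncMk_mem (d := d) hB.X_mem_polyGrading)
      (truncMk_mem (d := d) (monomial_mem_polyGrading (q := q) (j := i) (b := b) (by
        convert hpq using 2
        push_cast
        ring)))
    rw [← map_mul, X_mul_monomial] at this
    exact this

lemma IsStdGradedArtinian.truncation (hB : IsStdGradedArtinian k B 𝒜) (d : ℕ) :
    IsStdGradedArtinian k (TruncPoly B d) (truncGrading 𝒜 d) where
  internal := by
    rw [DirectSum.isInternal_submodule_iff_iSupIndep_and_iSup_eq_top]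
    constructor
    · intro j
      rw [Submodule.disjoint_def]
      intro c hc hc'
      refine eq_zero_of_truncCoeff (k := k) fun q hq => ?_
      refine (Submodule.disjoint_def.1 (hB.internal.submodule_iSupIndep (j - q))) _
        (truncCoeff_mem hq hc) ?_
      have hle : ⨆ (j') (_ : j' ≠ j), truncGrading 𝒜 d j' ≤
          (⨆ (i) (_ : i ≠ j - q), 𝒜 i).comap (truncCoeff k q hq) := by
        refine iSup₂_le fun j' hj' c hc => ?_
        exact Submodule.mem_iSup_of_mem (j' - q) (Submodule.mem_iSup_of_mem
          (fun h => hj' (by linarith)) (truncCoeff_mem hq hc))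
      exact hle hc'
    · rw [eq_top_iff]
      rintro c -
      obtain ⟨p, rfl⟩ := truncMk_surjective (k := k) c
      rw [p.as_sum_support, map_sum]
      refine sum_mem fun q _ => ?_
      generalize p.coeff q = b
      have hb : b ∈ ⨆ i, 𝒜 i := by rw [hB.internal.submodule_iSup_eq_top]; trivial
      induction hb using Submodule.iSup_induction' with
      | mem i b hb =>
        exact Submodule.mem_iSup_of_mem (i + q)
          (truncMk_mem (monomial_mem_polyGrading (by simpa using hb)))
      | zero => rw [map_zero, map_zero]; exact zero_mem _
      | add u v _ _ hu hv => rw [map_add, map_add]; exact add_mem hu hv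
  one_mem := by
    have := truncMk_mem (d := d) (C_mem_polyGrading hB.one_mem)
    rwa [map_one, map_one] at this
  mul_mem := by
    rintro i j _ _ ⟨p, hp, rfl⟩ ⟨p', hp', rfl⟩
    have := truncMk_mem (d := d) (hB.mul_mem_polyGrading hp hp')
    rwa [map_mul] at this
  neg_bot i hi := by
    rw [eq_bot_iff]
    rintro _ ⟨p, hp, rfl⟩
    have : p = 0 := by
      ext q
      have := hp q
      rw [hB.neg_bot _ (by omega)] at this
      simpa using this
    simp [this]
  zero_spanOne := by
    apply le_antisymm
    · rintro _ ⟨p, hp, rfl⟩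
      have h0 := hp 0
      rw [Nat.cast_zero, sub_zero, hB.zero_spanOne, Submodule.mem_span_singleton] at h0
      obtain ⟨c, hc⟩ := h0
      have : p = c • 1 := by
        ext q
        cases q with
        | zero => simp [← hc]
        | succ q =>
          have := hp (q + 1)
          rw [hB.neg_bot _ (by push_cast; omega)] at this
          rw [(Submodule.mem_bot k).1 this]
          simp [coeff_one]
      rw [this, map_smul]
      refine Submodule.smul_mem _ _ ?_
      have h1 : (truncMk k d).toLinearMap (1 : B[X]) = 1 := map_one (truncMk k d)
      rw [h1]
      exact Submodule.mem_span_singleton_self _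
    · rw [Submodule.span_singleton_le_iff_mem]
      have := truncMk_mem (d := d) (C_mem_polyGrading hB.one_mem)
      rwa [map_one, map_one] at this
  succ_eq i hi := by
    apply le_antisymm (hB.truncGrading_succ_le d hi)
    rw [Submodule.mul_le]
    rintro _ ⟨p, hp, rfl⟩ _ ⟨p', hp', rfl⟩
    have := truncMk_mem (d := d) (hB.mul_mem_polyGrading hp hp')
    rwa [map_mul, add_comm] at this
  finiteDim := by
    have := hB.finiteDim
    let F : TruncPoly B d →ₗ[k] (Fin d → B) := LinearMap.pi fun q => truncCoeff k q q.2
    refine FiniteDimensional.of_injective F ?_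
    rw [← LinearMap.ker_eq_bot, LinearMap.ker_eq_bot']
    intro c hc
    exact eq_zero_of_truncCoeff (k := k) fun q hq => congrFun hc ⟨q, hq⟩

lemma IsStdGradedArtinian.isMultiCIExtension_truncGrading (hB : IsStdGradedArtinian k B 𝒜)
    (d : ℕ) :
    IsMultiCIExtension 𝒜 (truncGrading 𝒜 d) (truncInc k d)
      (fun _ : Fin 1 => truncMk k d X) (fun _ => d) where
  map_mem j b hb := truncMk_mem (C_mem_polyGrading hb)
  x_mem _ := truncMk_mem hB.X_mem_polyGrading
  x_pow _ := truncMk_X_pow d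
  decomp_mem j f hf := by
    refine sum_mem fun e _ => ?_
    rw [Fin.prod_univ_one, truncInc_apply, ← map_pow, ← map_mul, X_pow_mul_C,
      C_mul_X_pow_eq_monomial]
    exact truncMk_mem (monomial_mem_polyGrading (by simpa using hf e))
  decomp_exists j c hc := by
    refine ⟨fun e => truncCoeff k (e 0) (e 0).2 c, fun e => ?_, ?_⟩
    · simpa using truncCoeff_mem (e 0).2 hc
    · rw [← sub_eq_zero]
      refine eq_zero_of_truncCoeff (k := k) fun q hq => ?_
      rw [map_sub, map_sum, Finset.sum_eq_single (fun _ : Fin 1 => (⟨q, hq⟩ : Fin d))]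
      · rw [Fin.prod_univ_one, truncCoeff_X_pow_mul_inc, if_pos rfl, sub_self]
      · intro e _ he
        rw [Fin.prod_univ_one, truncCoeff_X_pow_mul_inc, if_neg]
        intro h
        apply he
        ext m
        rw [Subsingleton.elim m 0]
        exact h
      · simp
  decomp_unique j f _ h0 e := by
    have h := congrArg (truncCoeff k (e 0) (e 0).2) h0
    rw [map_zero, map_sum, Finset.sum_eq_single e] at h
    · rwa [Fin.prod_univ_one, truncCoeff_X_pow_mul_inc, if_pos rfl] at h
    · intro e' _ he
      rw [Fin.prod_univ_one, truncCoeff_X_pow_mul_inc, if_neg]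
      intro h
      apply he
      ext m
      rw [Subsingleton.elim m 0]
      exact h
    · simp

end Truncation

section Converse

open Polynomial

variable {k B : Type*} [Field k] [CommRing B] [Algebra k B] {𝒜 : ℤ → Submodule k B}

lemma IsStdGradedArtinian.sum_pow_mul_pow_mem (hB : IsStdGradedArtinian k B 𝒜) {z l : B}
    (hz : z ∈ 𝒜 1) (hl : l ∈ 𝒜 1) (c : ℕ → ℕ) (s : ℕ) :
    ∑ q ∈ Finset.range (s + 1), (c q : B) * (z ^ q * l ^ (s - q)) ∈ 𝒜 s := by
  refine sum_mem fun q hq => ?_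
  have hq' : q < s + 1 := Finset.mem_range.1 hq
  rw [← nsmul_eq_mul]
  refine nsmul_mem (hB.pow_mul_mem hz q (i := (s - q : ℕ)) (by omega) ?_) _
  simpa using hB.pow_mem hl (s - q)

lemma truncCoeff_sum_mul_inc (c : ℕ → ℕ) (a : k) (ℓ b : B) (s : ℕ) :
    truncCoeff k s (Nat.lt_succ_self s)
      ((∑ q ∈ Finset.range (s + 1), (c q : TruncPoly B (s + 1)) *
        ((a • truncMk k (s + 1) X) ^ q * truncInc k (s + 1) ℓ ^ (s - q))) *
          truncInc k (s + 1) b) = ((c s : k) * a ^ s) • b := by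
  have hterm : ∀ q, (c q : TruncPoly B (s + 1)) *
      ((a • truncMk k (s + 1) X) ^ q * truncInc k (s + 1) ℓ ^ (s - q)) * truncInc k (s + 1) b =
      ((c q : k) * a ^ q) • (truncMk k (s + 1) X ^ q * truncInc k (s + 1) (ℓ ^ (s - q) * b)) := by
    intro q
    rw [_root_.smul_pow, map_mul, map_pow, mul_smul, Nat.cast_smul_eq_nsmul, nsmul_eq_mul,
      smul_mul_assoc, mul_assoc, smul_mul_assoc, mul_assoc]
  rw [Finset.sum_mul, map_sum, Finset.sum_eq_single s]
  · rw [hterm, map_smul, truncCoeff_X_pow_mul_inc, if_pos rfl, Nat.sub_self, pow_zero, one_mul]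
  · intro q _ hq
    rw [hterm, map_smul, truncCoeff_X_pow_mul_inc, if_neg hq, smul_zero]
  · simp

lemma truncInc_injective {d : ℕ} (hd : 0 < d) {b : B} (hb : truncInc k d b = 0) : b = 0 := by
  have h := congrArg (truncCoeff k 0 hd) hb
  rwa [map_zero, ← one_mul (truncInc k d b), ← pow_zero (truncMk k d X),
    truncCoeff_X_pow_mul_inc, if_pos rfl] at h

/-- A linear form of `B[X]/(X ^ d)` is the sum of a linear form of `B` and a multiple of `X`. -/
lemma IsStdGradedArtinian.exists_truncInc_sub (hB : IsStdGradedArtinian k B 𝒜) {d : ℕ}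
    {y : TruncPoly B d} (hy : y ∈ truncGrading 𝒜 d 1) :
    ∃ ℓ ∈ 𝒜 1, ∃ a : k, y = truncInc k d ℓ - a • truncMk k d X := by
  obtain ⟨p, hp, rfl⟩ := hy
  have h1 := hp 1
  rw [Nat.cast_one, sub_self, hB.zero_spanOne, Submodule.mem_span_singleton] at h1
  obtain ⟨a, ha⟩ := h1
  refine ⟨p.coeff 0, by simpa using hp 0, -a, ?_⟩
  rw [truncInc_apply, neg_smul, sub_neg_eq_add, ← map_smul, ← map_add]
  have : p = C (p.coeff 0) + a • X := by
    ext q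
    rcases q with _ | _ | q
    · simp
    · simp [← ha]
    · have := hp (q + 2)
      rw [hB.neg_bot _ (by push_cast; omega)] at this
      rw [(Submodule.mem_bot k).1 this]
      simp [coeff_X]
  exact congrArg _ this

lemma multichoose_mul_pow_ne_zero [CharZero k] {a : k} (ha : a ≠ 0) {t : ℕ} (ht : 1 ≤ t) (s : ℕ) :
    ((t.multichoose s : ℕ) : k) * a ^ s ≠ 0 := by
  refine mul_ne_zero (Nat.cast_ne_zero.2 ?_) (pow_ne_zero _ ha)
  rw [Nat.multichoose_eq]
  exact (Nat.choose_pos (by omega)).ne'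

/-- An injective power of a linear form on `B[X]/(X ^ (s + 1))` bounds the Hilbert function
of `B`. -/
lemma IsStdGradedArtinian.hilb_le_of_mulInjOn_truncGrading [CharZero k]
    (hB : IsStdGradedArtinian k B 𝒜) {i : ℤ} {r s : ℕ} (hr : 1 ≤ r) {y : TruncPoly B (s + 1)}
    (hy : y ∈ truncGrading 𝒜 (s + 1) 1)
    (h : MulInjOn (truncGrading 𝒜 (s + 1) i) (y ^ (r + s))) :
    hilb 𝒜 i ≤ hilb 𝒜 (i + r) ∧ hilb 𝒜 (i - s) ≤ hilb 𝒜 (i + r + s) := by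
  have := hB.finiteDim
  obtain ⟨ℓ, hℓ, a, rfl⟩ := hB.exists_truncInc_sub hy
  have hz : (a • truncMk k (B := B) (s + 1) X) ^ (s + 1) = 0 := by
    rw [_root_.smul_pow, truncMk_X_pow, smul_zero]
  have hfst : MulInjOn (𝒜 i) (ℓ ^ r) := by
    intro v hv hv0
    refine truncInc_injective (k := k) s.succ_pos
      (h _ (truncMk_mem (C_mem_polyGrading hv)) ?_)
    rw [sub_pow_eq_pow_mul_sum hz, mul_right_comm]
    change truncInc k (s + 1) ℓ ^ r * truncInc k (s + 1) v * _ = 0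
    rw [← map_pow, ← map_mul, hv0, map_zero, zero_mul]
  have hle := hilb_le_of_mulInjOn (fun v hv => hB.pow_mul_mem hℓ r rfl hv) hfst
  refine ⟨hle, ?_⟩
  rcases eq_or_ne a 0 with rfl | ha
  · have hpow : MulInjOn (𝒜 i) (ℓ ^ (r + s)) := by
      intro v hv hv0
      refine truncInc_injective (k := k) s.succ_pos
        (h _ (truncMk_mem (C_mem_polyGrading hv)) ?_)
      change _ * truncInc k (s + 1) v = 0
      rw [zero_smul, sub_zero, ← map_pow, ← map_mul, hv0, map_zero]
    have hlow : MulInjOn (𝒜 (i - s)) (ℓ ^ s) := by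
      intro v hv hv0
      have hx := h (truncMk k (s + 1) X ^ s * truncInc k (s + 1) v)
        ((hB.truncation (s + 1)).pow_mul_mem (truncMk_mem hB.X_mem_polyGrading) s
          (sub_add_cancel i s) (truncMk_mem (C_mem_polyGrading hv))) (by
          rw [zero_smul, sub_zero, mul_left_comm, ← map_pow (truncInc k (s + 1)),
            ← map_mul (truncInc k (s + 1)), pow_add ℓ, mul_assoc, hv0, mul_zero, map_zero,
            mul_zero])
      have hc := congrArg (truncCoeff k s s.lt_succ_self) hx
      rwa [truncCoeff_X_pow_mul_inc, if_pos rfl, map_zero] at hc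
    refine (hilb_le_of_mulInjOn
      (fun v hv => hB.pow_mul_mem hℓ s (sub_add_cancel i s) hv) hlow).trans
      (hilb_le_of_mulInjOn
        (fun v hv => hB.pow_mul_mem hℓ (r + s) (by push_cast; ring) hv) hpow)
  · refine hilb_le_of_mulInjOn (a := ℓ ^ (r + s + s))
      (fun v hv => hB.pow_mul_mem hℓ (r + s + s) (by push_cast; ring) hv) ?_
    intro v hv hv0
    have hG := (hB.truncation (s + 1)).sum_pow_mul_pow_mem
      (Submodule.smul_mem _ a (truncMk_mem hB.X_mem_polyGrading))
      (truncMk_mem (C_mem_polyGrading hℓ)) (r + s).multichoose s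
    have hGv := (hB.truncation (s + 1)).mul_mem hG (truncMk_mem (C_mem_polyGrading hv))
    rw [add_sub_cancel] at hGv
    have hx := h _ hGv (by
      rw [← mul_assoc]
      change (truncInc k (s + 1) ℓ - _) ^ _ * (∑ q ∈ Finset.range (s + 1),
        ((r + s).multichoose q : TruncPoly B (s + 1)) * ((a • truncMk k (s + 1) X) ^ q *
          truncInc k (s + 1) ℓ ^ (s - q))) * truncInc k (s + 1) v = 0
      rw [sub_pow_mul_multichoose_sum hz, ← map_pow, ← map_mul, hv0, map_zero])
    have hc := congrArg (truncCoeff k s s.lt_succ_self) hx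
    rw [map_zero] at hc
    have hs := (truncCoeff_sum_mul_inc (r + s).multichoose a ℓ v s).symm.trans hc
    exact (smul_eq_zero.1 hs).resolve_left (multichoose_mul_pow_ne_zero ha (by omega) s)

/-- A surjective power of a linear form on `B[X]/(X ^ (s + 1))` bounds the Hilbert function
of `B`. -/
lemma IsStdGradedArtinian.hilb_le_of_mulSurjOnto_truncGrading [CharZero k]
    (hB : IsStdGradedArtinian k B 𝒜) {i : ℤ} {r s : ℕ} (hr : 1 ≤ r) {y : TruncPoly B (s + 1)}
    (hy : y ∈ truncGrading 𝒜 (s + 1) 1)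
    (h : MulSurjOnto (truncGrading 𝒜 (s + 1) i) (truncGrading 𝒜 (s + 1) (i + r + s))
      (y ^ (r + s))) :
    hilb 𝒜 (i + r) ≤ hilb 𝒜 i ∧ hilb 𝒜 (i + r + s) ≤ hilb 𝒜 (i - s) := by
  have := hB.finiteDim
  obtain ⟨ℓ, hℓ, a, rfl⟩ := hB.exists_truncInc_sub hy
  have hz : (a • truncMk k (B := B) (s + 1) X) ^ (s + 1) = 0 := by
    rw [_root_.smul_pow, truncMk_X_pow, smul_zero]
  have hxz := Submodule.smul_mem _ a (truncMk_mem (d := s + 1) hB.X_mem_polyGrading)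
  have hlz := truncMk_mem (d := s + 1) (C_mem_polyGrading hℓ)
  have htop : ∀ b ∈ 𝒜 (i + r), truncMk k (s + 1) X ^ s * truncInc k (s + 1) b ∈
      truncGrading 𝒜 (s + 1) (i + r + s) := fun b hb =>
    (hB.truncation (s + 1)).pow_mul_mem (truncMk_mem hB.X_mem_polyGrading) s rfl
      (truncMk_mem (C_mem_polyGrading hb))
  have hfst : MulSurjOnto (𝒜 i) (𝒜 (i + r)) (ℓ ^ r) := by
    intro b hb
    obtain ⟨f, hf, hfb⟩ := h _ (htop b hb)
    have hU := (hB.truncation (s + 1)).sum_pow_mul_pow_mem (neg_mem hxz) hlz (r + s).choose s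
    have hUf := truncCoeff_mem s.lt_succ_self ((hB.truncation (s + 1)).mul_mem hU hf)
    rw [add_sub_cancel_left] at hUf
    refine ⟨_, hUf, ?_⟩
    have hc := congrArg (truncCoeff k s s.lt_succ_self) hfb
    rw [truncCoeff_X_pow_mul_inc, if_pos rfl, sub_pow_eq_pow_mul_sum hz, mul_assoc, ← map_pow,
      truncCoeff_inc_mul] at hc
    exact hc
  have hle := hilb_le_of_mulSurjOnto (fun v hv => hB.pow_mul_mem hℓ r rfl hv) hfst
  refine ⟨hle, ?_⟩
  rcases eq_or_ne a 0 with rfl | ha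
  · rw [zero_smul, sub_zero, ← map_pow] at h
    have hlow : MulSurjOnto (𝒜 (i - s)) (𝒜 (i + r)) (ℓ ^ (r + s)) := by
      intro b hb
      obtain ⟨f, hf, hfb⟩ := h _ (htop b hb)
      refine ⟨_, truncCoeff_mem s.lt_succ_self hf, ?_⟩
      rw [← truncCoeff_inc_mul, hfb, truncCoeff_X_pow_mul_inc, if_pos rfl]
    have hhigh : MulSurjOnto (𝒜 (i + r)) (𝒜 (i + r + s)) (ℓ ^ s) := by
      intro b hb
      obtain ⟨f, hf, hfb⟩ := h _ (truncMk_mem (C_mem_polyGrading hb))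
      have hf0 := truncCoeff_mem s.succ_pos hf
      rw [Nat.cast_zero, sub_zero] at hf0
      refine ⟨ℓ ^ r * truncCoeff k 0 s.succ_pos f, hB.pow_mul_mem hℓ r rfl hf0, ?_⟩
      rw [← mul_assoc, ← pow_add, add_comm s, ← truncCoeff_inc_mul, hfb, truncCoeff_mk,
        coeff_C_zero]
    exact (hilb_le_of_mulSurjOnto (fun v hv => hB.pow_mul_mem hℓ s rfl hv) hhigh).trans
      (hilb_le_of_mulSurjOnto
        (fun v hv => hB.pow_mul_mem hℓ (r + s) (by push_cast; ring) hv) hlow)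
  · refine hilb_le_of_mulSurjOnto (a := ℓ ^ (r + s + s))
      (fun v hv => hB.pow_mul_mem hℓ (r + s + s) (by push_cast; ring) hv) ?_
    intro b hb
    obtain ⟨f, hf, hfb⟩ := h _ (truncMk_mem (C_mem_polyGrading hb))
    have hne := multichoose_mul_pow_ne_zero ha (show 1 ≤ r + s by omega) s
    refine ⟨(((r + s).multichoose s : k) * a ^ s)⁻¹ • truncCoeff k s s.lt_succ_self f,
      Submodule.smul_mem _ _ (truncCoeff_mem s.lt_succ_self hf), ?_⟩
    rw [mul_smul_comm, inv_smul_eq_iff₀ hne, ← truncCoeff_sum_mul_inc _ a ℓ b s,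
      ← truncCoeff_inc_mul, map_pow, ← sub_pow_mul_multichoose_sum hz (r + s),
      truncInc_apply b, ← hfb]
    congr 1
    ring

lemma IsStdGradedArtinian.almostCentered [CharZero k] (hB : IsStdGradedArtinian k B 𝒜)
    (h : ∀ s : ℕ, HasSLP (truncGrading 𝒜 (s + 1))) : AlmostCentered 𝒜 := by
  intro i j hij
  rcases lt_or_ge i 0 with hi | hi
  · refine ⟨fun _ s => ?_, fun hlt => ?_⟩
    · rw [hB.hilb_neg (show i - s < 0 by omega)]
      exact Nat.zero_le _
    · rw [hB.hilb_neg hi] at hlt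
      exact absurd hlt (Nat.not_lt_zero _)
  · obtain ⟨r, rfl⟩ := Int.le.dest hij.le
    have hr : 1 ≤ r := by omega
    have hcases : ∀ s : ℕ,
        (hilb 𝒜 i ≤ hilb 𝒜 (i + r) ∧ hilb 𝒜 (i - s) ≤ hilb 𝒜 (i + r + s)) ∨
        (hilb 𝒜 (i + r) ≤ hilb 𝒜 i ∧ hilb 𝒜 (i + r + s) ≤ hilb 𝒜 (i - s)) := by
      intro s
      obtain ⟨y, hy, hfull⟩ := h s
      have hfull' := hfull i hi (r + s) (by omega)
      rw [Nat.cast_add, ← add_assoc] at hfull'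
      exact hfull'.imp (hB.hilb_le_of_mulInjOn_truncGrading hr hy)
        (hB.hilb_le_of_mulSurjOnto_truncGrading hr hy)
    constructor <;> intro hlt s <;> rcases hcases s with h1 | h1 <;> omega

/-- Adjoining a variable `x` with `x = 0` does not change the algebra. -/
lemma isMultiCIExtension_id (𝒜 : ℤ → Submodule k B) :
    IsMultiCIExtension 𝒜 𝒜 (AlgHom.id k B) (fun _ : Fin 1 => 0) (fun _ => 1) where
  map_mem _ _ hb := hb
  x_mem _ := zero_mem _
  x_pow _ := pow_one 0
  decomp_mem j f hf := by
    refine sum_mem fun e _ => ?_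
    simpa using hf e
  decomp_exists j c hc := ⟨fun _ => c, fun e => by simpa using hc, by simp⟩
  decomp_unique j f _ h0 e := by
    rw [Fintype.sum_unique] at h0
    rw [Subsingleton.elim e default]
    simpa using h0

end Converse

/-- Over a field `k` of characteristic zero, a standard graded artinian
`k`-algebra `B` is such that `B ⊗ₖ k[x₁,…,xₙ]/(x₁^{d₁},…,xₙ^{dₙ})` has the strong Lefschetz
property for every `n ≥ 1` and all `d₁,…,dₙ ≥ 1` if and only if `B` is almost centered and
has the strong Lefschetz property. -/
theorem statement_17 {k B : Type} [Field k] [CharZero k]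
    [CommRing B] [Algebra k B]
    (𝒜 : ℤ → Submodule k B) (hB : IsStdGradedArtinian k B 𝒜) :
    (∀ (n : ℕ), 1 ≤ n → ∀ (dv : Fin n → ℕ), (∀ j, 1 ≤ dv j) →
      ∀ (A : Type) [CommRing A] [Algebra k A],
        ∀ (ℬ : ℤ → Submodule k A) (φ : B →ₐ[k] A) (x : Fin n → A),
          IsStdGradedArtinian k A ℬ → IsMultiCIExtension 𝒜 ℬ φ x dv → HasSLP ℬ) ↔
      (AlmostCentered 𝒜 ∧ HasSLP 𝒜) := by
  constructor
  · intro h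
    refine ⟨hB.almostCentered fun s => ?_, ?_⟩
    · exact h 1 le_rfl _ (fun _ => Nat.succ_pos s) _ _ _ _ (hB.truncation (s + 1))
        (hB.isMultiCIExtension_truncGrading (s + 1))
    · exact h 1 le_rfl _ (fun _ => le_rfl) _ _ _ _ hB (isMultiCIExtension_id 𝒜)
  · rintro ⟨hac, ℓ, hℓ, hfull⟩ n _ dv hdv A _ _ ℬ φ x hℬ hA
    obtain ⟨N, hN⟩ := hB.exists_centeredAt hac hℓ hfull
    have ha : ∀ m, dv m - 1 + 1 = dv m := fun m => Nat.sub_add_cancel (hdv m)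
    refine ⟨φ ℓ + ∑ m, x m,
      add_mem (hA.map_mem 1 ℓ hℓ) (sum_mem fun m _ => hA.x_mem m), fun i _ t _ => ?_⟩
    rcases le_or_gt (2 * i + t) (N + ∑ m, ((dv m - 1 : ℕ) : ℤ)) with hi | hi
    · exact Or.inl (IsMultiCIExtension.mulInjOn hB hA ha hℓ hN i t hi)
    · exact Or.inr (IsMultiCIExtension.mulSurjOnto hB hℬ hA ha hℓ hN i t hi)
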